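/- Let p be an odd prime and let K be an algebraic closure of 𝔽_p. Then there exists a homogeneous polynomial f of degree 4 in K[x,y,z,w] such that: (i) f^{p−2} lies in the ideal (x^p, y^p, z^p, w^p), and (ii) the radical of the ideal generated by f together with its four partial derivatives equals the maximal ideal (x, y, z, w) (so f defines a smooth quartic, i.e. K3, surface in ℙ³). -/

import Mathlib

open MvPolynomial

/-- The binary quartic `a b (a - b) (a - l b)`, whose double cover `y² = x (x - 1) (x - l)` is the
Legendre elliptic curve with parameter `l`. -/
def legendreQuartic {R : Type*} [CommRing R] (l a b : R) : R :=
  a * b * (a - b) * (a - l * b)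

/-- The Hasse polynomial, evaluated at `l`, is the middle coefficient of the `m`-th power of the
Legendre quartic, up to sign. -/
theorem legendreQuartic_pow_eq_zero {R : Type*} [CommRing R] {l a b : R} {m : ℕ}
    (ha : a ^ (2 * m + 1) = 0) (hb : b ^ (2 * m + 1) = 0)
    (hl : ∑ i ∈ Finset.range (m + 1), (m.choose i : R) ^ 2 * l ^ i = 0) :
    legendreQuartic l a b ^ m = 0 := by
  have expand : legendreQuartic l a b ^ m =
      ∑ i ∈ Finset.range (m + 1), ∑ j ∈ Finset.range (m + 1), a ^ m * b ^ m *
        ((a ^ i * (-b) ^ (m - i) * (m.choose i : R)) *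
          ((-(l * b)) ^ j * a ^ (m - j) * (m.choose j : R))) := by
    have h : legendreQuartic l a b = a * b * ((a + -b) * (-(l * b) + a)) := by
      unfold legendreQuartic; ring
    rw [h, mul_pow, mul_pow, mul_pow, add_pow, add_pow, Finset.sum_mul_sum, Finset.mul_sum]
    simp_rw [Finset.mul_sum]
  have diagonal : ∀ i ∈ Finset.range (m + 1),
      ∑ j ∈ Finset.range (m + 1), a ^ m * b ^ m *
        ((a ^ i * (-b) ^ (m - i) * (m.choose i : R)) *
          ((-(l * b)) ^ j * a ^ (m - j) * (m.choose j : R))) =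
      (-1) ^ m * a ^ (2 * m) * b ^ (2 * m) * ((m.choose i : R) ^ 2 * l ^ i) := by
    intro i hi
    have him : i ≤ m := by simpa [Nat.lt_succ_iff] using hi
    rw [Finset.sum_eq_single_of_mem i hi]
    · obtain ⟨k, rfl⟩ := Nat.exists_eq_add_of_le him
      rw [Nat.add_sub_cancel_left, neg_pow b, neg_pow (l * b)]
      ring
    · intro j hj hji
      have hjm : j ≤ m := by simpa [Nat.lt_succ_iff] using hj
      rcases lt_or_gt_of_ne hji with h | h
      · have h0 : a ^ m * a ^ i * a ^ (m - j) = 0 := by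
          rw [← pow_add, ← pow_add]
          exact pow_eq_zero_of_le (by omega) ha
        linear_combination (b ^ m * (-b) ^ (m - i) * (m.choose i : R) * (-(l * b)) ^ j *
          (m.choose j : R)) * h0
      · have h0 : b ^ m * b ^ (m - i) * b ^ j = 0 := by
          rw [← pow_add, ← pow_add]
          exact pow_eq_zero_of_le (by omega) hb
        rw [neg_pow b, neg_pow (l * b), mul_pow l b]
        linear_combination (a ^ m * a ^ i * (-1) ^ (m - i) * (m.choose i : R) * (-1) ^ j * l ^ j *
          a ^ (m - j) * (m.choose j : R)) * h0
  rw [expand, Finset.sum_congr rfl diagonal, ← Finset.mul_sum, hl, mul_zero]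

/-- Over an algebraically closed field of odd characteristic there is a supersingular Legendre
parameter. -/
theorem exists_supersingular_legendre_parameter {K : Type*} [Field K] [IsAlgClosed K] {m : ℕ}
    [hp : Fact (2 * m + 1).Prime] [CharP K (2 * m + 1)] :
    ∃ l : K, l ≠ 0 ∧ l ≠ 1 ∧
      ∑ i ∈ Finset.range (m + 1), (m.choose i : K) ^ 2 * l ^ i = 0 := by
  have hm : m ≠ 0 := by rintro rfl; exact Nat.not_prime_one hp.out
  let H : Polynomial K :=
    ∑ i ∈ Finset.range (m + 1), Polynomial.C ((m.choose i : K) ^ 2) * Polynomial.X ^ i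
  have hcoeff : H.coeff m = 1 := by
    simp only [H, Polynomial.finsetSum_coeff, Polynomial.coeff_C_mul_X_pow]
    simp
  have hdeg : H.degree ≠ 0 := by
    intro h
    have := Polynomial.coeff_eq_zero_of_degree_lt (p := H) (n := m)
      (by rw [h]; exact_mod_cast Nat.pos_of_ne_zero hm)
    rw [hcoeff] at this
    exact one_ne_zero this
  obtain ⟨l, hl⟩ := IsAlgClosed.exists_root H hdeg
  have hl' : ∑ i ∈ Finset.range (m + 1), (m.choose i : K) ^ 2 * l ^ i = 0 := by
    simpa [H, Polynomial.IsRoot, Polynomial.eval_finsetSum] using hl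
  refine ⟨l, ?_, ?_, hl'⟩
  · rintro rfl
    simp [Finset.sum_range_succ'] at hl'
  · rintro rfl
    have h : ((∑ i ∈ Finset.range (m + 1), m.choose i ^ 2 : ℕ) : K) = 0 := by
      push_cast
      simpa using hl'
    rw [Nat.sum_range_choose_sq, CharP.cast_eq_zero_iff K (2 * m + 1)] at h
    have hdvd : (2 * m).choose m ∣ (2 * m).factorial :=
      ⟨_, by rw [← mul_assoc]; exact (Nat.choose_mul_factorial_mul_factorial (by omega)).symm⟩
    have := (Nat.Prime.dvd_factorial hp.out).1 (h.trans hdvd)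
    omega

/-- The Legendre quartic with parameter different from `0` and `1` has no singular zero other than
the origin. -/
theorem eq_zero_of_legendreQuartic_partials_eq_zero {K : Type*} [Field K] (h2 : (2 : K) ≠ 0)
    {l a b : K} (h0 : l ≠ 0) (h1 : l ≠ 1)
    (ha : 3 * a ^ 2 * b - 2 * (1 + l) * a * b ^ 2 + l * b ^ 3 = 0)
    (hb : a ^ 3 - 2 * (1 + l) * a ^ 2 * b + 3 * l * a * b ^ 2 = 0) : a = 0 ∧ b = 0 := by
  by_cases hb0 : b = 0
  · subst hb0
    exact ⟨by simpa using hb, rfl⟩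
  by_cases ha0 : a = 0
  · subst ha0
    exact ⟨rfl, by simpa [h0] using ha⟩
  exfalso
  have hg : (2 : K) * 2 * a * b * (a - b) * (a - l * b) = 0 := by
    linear_combination a * ha + b * hb
  have hl : l - 1 ≠ 0 := sub_ne_zero.2 h1
  rcases mul_eq_zero.1 hg with h | h
  · have hab : a = b := by simpa [h2, ha0, hb0, sub_eq_zero] using h
    subst hab
    have : (l - 1) * a ^ 3 = 0 := by linear_combination -ha
    simp [hl, ha0] at this
  · have hab : a = l * b := sub_eq_zero.1 h
    subst hab
    have : l * (l - 1) * b ^ 3 = 0 := by linear_combination ha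
    simp [hl, h0, hb0] at this

theorem isHomogeneous_legendreQuartic {K σ : Type*} [CommRing K] (l : K) (i j : σ) :
    (legendreQuartic (C l) (X i) (X j) : MvPolynomial σ K).IsHomogeneous 4 := by
  have hi := isHomogeneous_X K i
  have hj := isHomogeneous_X K j
  have hlj : (C l * X j : MvPolynomial σ K).IsHomogeneous 1 := by
    simpa using (isHomogeneous_C σ l).mul hj
  exact ((hi.mul hj).mul (hi.sub hj)).mul (hi.sub hlj)

theorem vanishingIdeal_singleton_zero {K σ : Type*} [Field K] :
    vanishingIdeal K {(0 : σ → K)} = idealOfVars σ K := by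
  ext g
  rw [mem_vanishingIdeal_singleton_iff, idealOfVars, ← Set.image_univ, mem_ideal_span_X_image,
    aeval_zero, Algebra.algebraMap_self, RingHom.id_apply, constantCoeff_eq, ← notMem_support_iff]
  constructor
  · intro h m hm
    by_contra! hc
    have : m = 0 := Finsupp.ext fun i => hc i (Set.mem_univ i)
    exact h (this ▸ hm)
  · intro h h0
    obtain ⟨i, -, hi⟩ := h 0 h0
    exact hi rfl

theorem idealOfVars_fin_four (K : Type*) [CommRing K] :
    idealOfVars (Fin 4) K = Ideal.span {X 0, X 1, X 2, X 3} := by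
  have h : Set.range (X : Fin 4 → MvPolynomial (Fin 4) K) = {X 0, X 1, X 2, X 3} := by
    ext g
    simp [Fin.exists_fin_succ, eq_comm]
  rw [idealOfVars, h]

/-- In odd characteristic, the sum of two copies of a supersingular Legendre quartic in disjoint
variables is a smooth quartic with `f ^ (p - 2)` in the Frobenius power of the maximal ideal. -/
theorem exists_smooth_quartic_pow_mem_frobeniusPower {K : Type*} [Field K] [IsAlgClosed K] {m : ℕ}
    [hp : Fact (2 * m + 1).Prime] [CharP K (2 * m + 1)] :
    let x : MvPolynomial (Fin 4) K := X 0
    let y : MvPolynomial (Fin 4) K := X 1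
    let z : MvPolynomial (Fin 4) K := X 2
    let w : MvPolynomial (Fin 4) K := X 3
    ∃ f : MvPolynomial (Fin 4) K,
      f.IsHomogeneous 4 ∧
      f ^ (2 * m + 1 - 2) ∈
        Ideal.span {x ^ (2 * m + 1), y ^ (2 * m + 1), z ^ (2 * m + 1), w ^ (2 * m + 1)} ∧
      (Ideal.span {f, pderiv 0 f, pderiv 1 f, pderiv 2 f, pderiv 3 f}).radical =
        Ideal.span {x, y, z, w} := by
  intro x y z w
  have hm : m ≠ 0 := by rintro rfl; exact Nat.not_prime_one hp.out
  have h2 : (2 : K) ≠ 0 := by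
    intro h
    have h' : ((2 : ℕ) : K) = 0 := by exact_mod_cast h
    rw [CharP.cast_eq_zero_iff K (2 * m + 1)] at h'
    have := Nat.le_of_dvd two_pos h'
    omega
  obtain ⟨l, hl0, hl1, hl⟩ := exists_supersingular_legendre_parameter (K := K) (m := m)
  refine ⟨legendreQuartic (C l) x y + legendreQuartic (C l) z w,
    (isHomogeneous_legendreQuartic l 0 1).add (isHomogeneous_legendreQuartic l 2 3), ?_, ?_⟩
  · set I := Ideal.span {x ^ (2 * m + 1), y ^ (2 * m + 1), z ^ (2 * m + 1), w ^ (2 * m + 1)}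
    let π := Ideal.Quotient.mk I
    have hgen : ∀ v, v ^ (2 * m + 1) ∈ I → π v ^ (2 * m + 1) = 0 := fun v hv => by
      rw [← map_pow]; exact Ideal.Quotient.eq_zero_iff_mem.2 hv
    have hsum : ∑ i ∈ Finset.range (m + 1),
        (m.choose i : MvPolynomial (Fin 4) K ⧸ I) ^ 2 * π (C l) ^ i = 0 := by
      simpa only [RingHom.comp_apply, map_sum, map_mul, map_pow, map_natCast, map_zero] using
        congrArg (π.comp C) hl
    have hπ : ∀ a b, π (legendreQuartic (C l) a b) = legendreQuartic (π (C l)) (π a) (π b) := by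
      intro a b; simp [legendreQuartic]
    rw [← Ideal.Quotient.eq_zero_iff_mem, map_pow]
    change π _ ^ _ = 0
    rw [map_add, hπ, hπ]
    refine (Commute.all _ _).add_pow_eq_zero_of_add_le_succ_of_pow_eq_zero
      (legendreQuartic_pow_eq_zero (hgen _ ?_) (hgen _ ?_) hsum)
      (legendreQuartic_pow_eq_zero (hgen _ ?_) (hgen _ ?_) hsum) (by omega)
    all_goals exact Ideal.subset_span (by simp)
  · set f := legendreQuartic (C l) x y + legendreQuartic (C l) z w with hf
    have hpartial : ∀ v : Fin 4 → K,
        eval v (pderiv 0 f) = 3 * v 0 ^ 2 * v 1 - 2 * (1 + l) * v 0 * v 1 ^ 2 + l * v 1 ^ 3 ∧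
        eval v (pderiv 1 f) = v 0 ^ 3 - 2 * (1 + l) * v 0 ^ 2 * v 1 + 3 * l * v 0 * v 1 ^ 2 ∧
        eval v (pderiv 2 f) = 3 * v 2 ^ 2 * v 3 - 2 * (1 + l) * v 2 * v 3 ^ 2 + l * v 3 ^ 3 ∧
        eval v (pderiv 3 f) = v 2 ^ 3 - 2 * (1 + l) * v 2 ^ 2 * v 3 + 3 * l * v 2 * v 3 ^ 2 := by
      intro v
      refine ⟨?_, ?_, ?_, ?_⟩ <;>
      · simp [hf, legendreQuartic, x, y, z, w, pderiv_X, Derivation.leibniz]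
        ring
    have hlocus :
        zeroLocus K (Ideal.span {f, pderiv 0 f, pderiv 1 f, pderiv 2 f, pderiv 3 f}) = {0} := by
      ext v
      obtain ⟨e0, e1, e2, e3⟩ := hpartial v
      simp only [zeroLocus_span, Set.mem_ofPred_eq, Set.mem_insert_iff, Set.mem_singleton_iff,
        forall_eq_or_imp, forall_eq, aeval_eq_eval, e0, e1, e2, e3]
      constructor
      · rintro ⟨-, d0, d1, d2, d3⟩
        obtain ⟨h0, h1⟩ := eq_zero_of_legendreQuartic_partials_eq_zero h2 hl0 hl1 d0 d1
        obtain ⟨h2, h3⟩ := eq_zero_of_legendreQuartic_partials_eq_zero h2 hl0 hl1 d2 d3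
        ext i
        fin_cases i <;> assumption
      · rintro rfl
        simp [hf, legendreQuartic, x, y, z, w]
    rw [← vanishingIdeal_zeroLocus_eq_radical (K := K), hlocus, ← idealOfVars_fin_four,
      vanishingIdeal_singleton_zero]

theorem stmt_11 (p : ℕ) [hp : Fact p.Prime] (hodd : Odd p) :
    let K := AlgebraicClosure (ZMod p)
    let x : MvPolynomial (Fin 4) K := X 0
    let y : MvPolynomial (Fin 4) K := X 1
    let z : MvPolynomial (Fin 4) K := X 2
    let w : MvPolynomial (Fin 4) K := X 3
    ∃ f : MvPolynomial (Fin 4) K,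
      f.IsHomogeneous 4 ∧
      f ^ (p - 2) ∈ Ideal.span {x ^ p, y ^ p, z ^ p, w ^ p} ∧
      (Ideal.span {f, pderiv 0 f, pderiv 1 f, pderiv 2 f, pderiv 3 f}).radical =
        Ideal.span {x, y, z, w} := by
  obtain ⟨m, rfl⟩ := hodd
  exact exists_smooth_quartic_pow_mem_frobeniusPower
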